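/- For the Gaussian trace estimator of an SPSD matrix A, if the sample size satisfies n ≥ 8 ε^{-2} ln(2/δ), then Pr(|tr_G(A) - tr(A)| ≤ ε tr(A)) ≥ 1 - δ, where tr_G(A) = (1/n) sum_{i=1}^n (w_i, A w_i) with i.i.d. standard Gaussian vectors w_i. -/

import Mathlib

open MeasureTheory Matrix ProbabilityTheory Real

lemma one_add_le_exp_sub_sq_div_four {x : ℝ} (hx : |x| < 1) :
    1 + x ≤ exp (x - x ^ 2 / 4) := by
  obtain ⟨h1, h2⟩ := abs_lt.mp hx
  rcases le_or_gt 0 x with h0 | h0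
  · have h := quadratic_le_exp_of_nonneg (x := x - x ^ 2 / 4) (by nlinarith)
    nlinarith [mul_nonneg h0 h0, mul_nonneg (mul_nonneg h0 h0) (sub_nonneg.2 h2.le),
      sq_nonneg (x ^ 2)]
  · have hs := hasSum_pow_div_log_of_abs_lt_one (x := -x) (by simpa using hx)
    have hle := sum_le_hasSum (Finset.range 2) (fun i _ => by
      have : 0 < -x := by linarith
      positivity) hs
    rw [← log_le_iff_le_exp (by linarith)]
    norm_num [Finset.sum_range_succ] at hle
    nlinarith [sq_nonneg x]

lemma gaussianPDFReal_smul_exp_mul_sq (t x : ℝ) :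
    gaussianPDFReal 0 1 x • exp (t * x ^ 2) = (√(2 * π))⁻¹ * exp (-(1 / 2 - t) * x ^ 2) := by
  simp only [gaussianPDFReal, NNReal.coe_one, mul_one, sub_zero, smul_eq_mul]
  rw [mul_assoc, ← exp_add]
  ring_nf

lemma integrable_exp_mul_sq_gaussianReal {t : ℝ} (ht : t < 1 / 2) :
    Integrable (fun x : ℝ => exp (t * x ^ 2)) (gaussianReal 0 1) := by
  rw [gaussianReal_of_var_ne_zero 0 one_ne_zero,
    integrable_withDensity_iff_integrable_smul' (measurable_gaussianPDF 0 1)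
      (ae_of_all _ fun _ => gaussianPDF_lt_top)]
  simp_rw [toReal_gaussianPDF, gaussianPDFReal_smul_exp_mul_sq]
  exact (integrable_exp_neg_mul_sq (by linarith)).const_mul _

lemma integral_exp_mul_sq_gaussianReal {t : ℝ} (ht : t < 1 / 2) :
    ∫ x, exp (t * x ^ 2) ∂gaussianReal 0 1 = (√(1 - 2 * t))⁻¹ := by
  rw [integral_gaussianReal_eq_integral_smul one_ne_zero]
  simp_rw [gaussianPDFReal_smul_exp_mul_sq]
  rw [integral_const_mul, integral_gaussian, ← sqrt_inv, ← sqrt_inv, ← sqrt_mul (by positivity)]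
  congr 1
  have : 1 / 2 - t ≠ 0 := by linarith
  have : 1 - 2 * t ≠ 0 := by linarith
  field_simp

lemma measurePreserving_inner_pi_gaussianReal {ι : Type*} [Fintype ι]
    (b : OrthonormalBasis ι ℝ (EuclideanSpace ℝ ι)) (i : ι) :
    MeasurePreserving (fun x : ι → ℝ => inner ℝ (b i) (WithLp.toLp 2 x))
      (Measure.pi fun _ : ι => gaussianReal 0 1) (gaussianReal 0 1) := by
  refine ⟨by fun_prop, ?_⟩
  have h : (fun x : ι → ℝ => inner ℝ (b i) (WithLp.toLp 2 x)) =
      (fun y : EuclideanSpace ℝ ι => inner ℝ (b i) y) ∘ WithLp.toLp 2 := rfl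
  rw [h, ← Measure.map_map (by fun_prop) (by fun_prop), map_pi_eq_stdGaussian,
    stdGaussian_eq_map_pi_orthonormalBasis b, Measure.map_map (by fun_prop) (by fun_prop)]
  have h' : (fun y : EuclideanSpace ℝ ι => inner ℝ (b i) y) ∘ (fun x : ι → ℝ => ∑ j, x j • b j) =
      Function.eval i := by
    ext x
    classical
    simp [inner_sum, inner_smul_right, b.inner_eq_ite]
  rw [h', (measurePreserving_eval _ i).map_eq]

lemma Matrix.IsHermitian.dotProduct_mulVec_eq_sum {ι : Type*} [Fintype ι] [DecidableEq ι]
    {A : Matrix ι ι ℝ} (hA : A.IsHermitian) (x : ι → ℝ) :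
    x ⬝ᵥ A.mulVec x =
      ∑ i, hA.eigenvalues i * inner ℝ (hA.eigenvectorBasis i) (WithLp.toLp 2 x) ^ 2 := by
  have hin (u v : EuclideanSpace ℝ ι) : inner ℝ u v = u.ofLp ⬝ᵥ v.ofLp := by
    simp [PiLp.inner_apply, dotProduct, mul_comm]
  have hev (i : ι) : inner ℝ (hA.eigenvectorBasis i) (WithLp.toLp 2 (A.mulVec x)) =
      hA.eigenvalues i * inner ℝ (hA.eigenvectorBasis i) (WithLp.toLp 2 x) := by
    have hAt : Aᵀ = A := by simpa using hA.eq
    rw [hin, hin, dotProduct_mulVec, ← mulVec_transpose, hAt, hA.mulVec_eigenvectorBasis,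
      smul_dotProduct, smul_eq_mul]
  have h := hA.eigenvectorBasis.sum_inner_mul_inner (WithLp.toLp 2 x) (WithLp.toLp 2 (A.mulVec x))
  rw [hin] at h
  rw [← h]
  refine Finset.sum_congr rfl fun i _ => ?_
  rw [hev, real_inner_comm]
  ring

section QuadraticForm

variable {ι : Type*} [Fintype ι] {A : Matrix ι ι ℝ}

lemma Matrix.PosSemidef.exp_quadraticForm_le [DecidableEq ι] (hA : A.PosSemidef)
    (htr : 0 < A.trace) (t : ℝ) (x : ι → ℝ) :
    exp (t * (x ⬝ᵥ A.mulVec x / A.trace)) ≤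
      ∑ i, hA.1.eigenvalues i / A.trace *
        exp (t * inner ℝ (hA.1.eigenvectorBasis i) (WithLp.toLp 2 x) ^ 2) := by
  have hsum : ∑ i, hA.1.eigenvalues i / A.trace = 1 := by
    rw [← Finset.sum_div, div_eq_one_iff_eq htr.ne']
    simpa using hA.1.trace_eq_sum_eigenvalues.symm
  have h := convexOn_exp.map_sum_le (t := Finset.univ)
    (w := fun i => hA.1.eigenvalues i / A.trace)
    (p := fun i => t * inner ℝ (hA.1.eigenvectorBasis i) (WithLp.toLp 2 x) ^ 2)
    (fun i _ => div_nonneg (hA.eigenvalues_nonneg i) htr.le) hsum (fun _ _ => Set.mem_univ _)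
  simp only [smul_eq_mul] at h
  refine le_trans (le_of_eq ?_) h
  rw [hA.1.dotProduct_mulVec_eq_sum, Finset.sum_div, Finset.mul_sum]
  congr 1
  exact Finset.sum_congr rfl fun i _ => by ring

lemma measurable_quadraticForm (A : Matrix ι ι ℝ) :
    Measurable fun x : ι → ℝ => x ⬝ᵥ A.mulVec x := by
  unfold dotProduct mulVec dotProduct
  fun_prop

lemma Matrix.PosSemidef.integrable_eigenvalue_mul_exp_inner_sq [DecidableEq ι]
    (hA : A.PosSemidef) {t : ℝ} (ht : t < 1 / 2) (i : ι) :
    Integrable (fun x : ι → ℝ => hA.1.eigenvalues i / A.trace *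
      exp (t * inner ℝ (hA.1.eigenvectorBasis i) (WithLp.toLp 2 x) ^ 2))
      (Measure.pi fun _ : ι => gaussianReal 0 1) :=
  ((measurePreserving_inner_pi_gaussianReal hA.1.eigenvectorBasis i).integrable_comp_of_integrable
    (integrable_exp_mul_sq_gaussianReal ht)).const_mul _

lemma Matrix.PosSemidef.integrable_exp_quadraticForm (hA : A.PosSemidef) (htr : 0 < A.trace)
    {t : ℝ} (ht : t < 1 / 2) :
    Integrable (fun x : ι → ℝ => exp (t * (x ⬝ᵥ A.mulVec x / A.trace)))
      (Measure.pi fun _ : ι => gaussianReal 0 1) := by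
  classical
  refine (integrable_finsetSum Finset.univ fun i _ =>
    hA.integrable_eigenvalue_mul_exp_inner_sq ht i).mono' ?_ (ae_of_all _ fun x => ?_)
  · have := measurable_quadraticForm A
    exact Measurable.aestronglyMeasurable (by fun_prop)
  · rw [norm_of_nonneg (exp_pos _).le]
    exact hA.exp_quadraticForm_le htr t x

lemma Matrix.PosSemidef.integral_exp_quadraticForm_le (hA : A.PosSemidef) (htr : 0 < A.trace)
    {t : ℝ} (ht : t < 1 / 2) :
    ∫ x, exp (t * (x ⬝ᵥ A.mulVec x / A.trace)) ∂(Measure.pi fun _ : ι => gaussianReal 0 1) ≤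
      (√(1 - 2 * t))⁻¹ := by
  classical
  have hint (i : ι) : ∫ x : ι → ℝ,
      exp (t * inner ℝ (hA.1.eigenvectorBasis i) (WithLp.toLp 2 x) ^ 2)
        ∂(Measure.pi fun _ : ι => gaussianReal 0 1) = (√(1 - 2 * t))⁻¹ := by
    have hmp := measurePreserving_inner_pi_gaussianReal hA.1.eigenvectorBasis i
    rw [← integral_exp_mul_sq_gaussianReal ht, ← integral_map (f := fun y => exp (t * y ^ 2))
      hmp.measurable.aemeasurable (by fun_prop), hmp.map_eq]
  refine (integral_mono (hA.integrable_exp_quadraticForm htr ht)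
    (integrable_finsetSum Finset.univ fun i _ => hA.integrable_eigenvalue_mul_exp_inner_sq ht i)
    (hA.exp_quadraticForm_le htr t)).trans_eq ?_
  rw [integral_finsetSum _ fun i _ => hA.integrable_eigenvalue_mul_exp_inner_sq ht i]
  simp_rw [integral_const_mul, hint]
  rw [← Finset.sum_mul, ← Finset.sum_div,
    show ∑ i, hA.1.eigenvalues i = A.trace by simpa using hA.1.trace_eq_sum_eigenvalues.symm,
    div_self htr.ne', one_mul]

end QuadraticForm

lemma measurePreserving_curry_pi {ι κ X : Type*} [Fintype ι] [Fintype κ] [MeasurableSpace X]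
    (ν : Measure X) [IsProbabilityMeasure ν] :
    MeasurePreserving (fun (x : ι × κ → X) i j => x (i, j))
      (Measure.pi fun _ => ν) (Measure.pi fun _ => Measure.pi fun _ => ν) := by
  refine ⟨by fun_prop, ?_⟩
  have h := Measure.infinitePi_map_curry (ι := ι) (κ := κ) (X := X) (fun _ _ => ν)
  simp only [Measure.infinitePi_eq_pi] at h
  exact h

section Sample

variable {ι κ : Type*} [Fintype ι] [Fintype κ] {A : Matrix ι ι ℝ}

lemma Matrix.PosSemidef.integrable_exp_sum_quadraticForm (hA : A.PosSemidef) (htr : 0 < A.trace)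
    {t : ℝ} (ht : t < 1 / 2) :
    Integrable (fun x : κ → ι → ℝ => exp (t * ∑ k, x k ⬝ᵥ A.mulVec (x k) / A.trace))
      (Measure.pi fun _ : κ => Measure.pi fun _ : ι => gaussianReal 0 1) := by
  simp_rw [Finset.mul_sum, exp_sum]
  exact Integrable.fintype_prod fun _ => hA.integrable_exp_quadraticForm htr ht

lemma Matrix.PosSemidef.mgf_sum_quadraticForm_le (hA : A.PosSemidef) (htr : 0 < A.trace)
    {t : ℝ} (ht : t < 1 / 2) :
    mgf (fun x : κ → ι → ℝ => ∑ k, x k ⬝ᵥ A.mulVec (x k) / A.trace)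
      (Measure.pi fun _ : κ => Measure.pi fun _ : ι => gaussianReal 0 1) t ≤
      (√(1 - 2 * t))⁻¹ ^ Fintype.card κ := by
  simp_rw [mgf, Finset.mul_sum, exp_sum]
  rw [integral_fintype_prod_eq_pow (fun x : ι → ℝ => exp (t * (x ⬝ᵥ A.mulVec x / A.trace)))]
  gcongr
  exact hA.integral_exp_quadraticForm_le htr ht

end Sample

lemma exp_neg_mul_inv_sqrt_pow_le {x : ℝ} (hx : |x| < 1) (n : ℕ) :
    exp (-(x / (2 * (1 + x))) * (n * (1 + x))) * (√(1 - 2 * (x / (2 * (1 + x)))))⁻¹ ^ n ≤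
      exp (-(n * (x ^ 2 / 8))) := by
  have h1 : 0 < 1 + x := by linarith [(abs_lt.mp hx).1]
  have hs : 1 - 2 * (x / (2 * (1 + x))) = (1 + x)⁻¹ := by field_simp; ring
  have he : -(x / (2 * (1 + x))) * (n * (1 + x)) = n * (-(x / 2)) := by field_simp
  rw [hs, he, sqrt_inv, inv_inv, exp_nat_mul, ← mul_pow, ← mul_neg, exp_nat_mul]
  gcongr
  have hsq : √(1 + x) ≤ exp ((x - x ^ 2 / 4) / 2) := by
    rw [exp_half]
    exact sqrt_le_sqrt (one_add_le_exp_sub_sq_div_four hx)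
  calc exp (-(x / 2)) * √(1 + x) ≤ exp (-(x / 2)) * exp ((x - x ^ 2 / 4) / 2) := by gcongr
    _ = exp (-(x ^ 2 / 8)) := by rw [← exp_add]; ring_nf

section Tails

variable {ι κ : Type*} [Fintype ι] [Fintype κ] {A : Matrix ι ι ℝ} {ε : ℝ}

lemma Matrix.PosSemidef.measureReal_sum_quadraticForm_ge_le (hA : A.PosSemidef)
    (htr : 0 < A.trace) (hε : ε ∈ Set.Ioo (0 : ℝ) 1) :
    (Measure.pi fun _ : κ => Measure.pi fun _ : ι => gaussianReal 0 1).real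
      {x | Fintype.card κ * (1 + ε) ≤ ∑ k, x k ⬝ᵥ A.mulVec (x k) / A.trace} ≤
      exp (-(Fintype.card κ * (ε ^ 2 / 8))) := by
  have hε0 := hε.1
  have ht : ε / (2 * (1 + ε)) < 1 / 2 := by
    rw [div_lt_div_iff₀ (by linarith) two_pos]; linarith
  refine (measure_ge_le_exp_mul_mgf _ (by positivity)
    (hA.integrable_exp_sum_quadraticForm htr ht)).trans ?_
  refine (mul_le_mul_of_nonneg_left (hA.mgf_sum_quadraticForm_le htr ht) (exp_pos _).le).trans ?_
  exact exp_neg_mul_inv_sqrt_pow_le (by rw [abs_of_pos hε0]; exact hε.2) _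

lemma Matrix.PosSemidef.measureReal_sum_quadraticForm_le_le (hA : A.PosSemidef)
    (htr : 0 < A.trace) (hε : ε ∈ Set.Ioo (0 : ℝ) 1) :
    (Measure.pi fun _ : κ => Measure.pi fun _ : ι => gaussianReal 0 1).real
      {x | ∑ k, x k ⬝ᵥ A.mulVec (x k) / A.trace ≤ Fintype.card κ * (1 - ε)} ≤
      exp (-(Fintype.card κ * (ε ^ 2 / 8))) := by
  obtain ⟨hε0, hε1⟩ := hε
  have ht0 : -ε / (2 * (1 + -ε)) ≤ 0 :=
    div_nonpos_of_nonpos_of_nonneg (by linarith) (by linarith)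
  have ht : -ε / (2 * (1 + -ε)) < 1 / 2 := by linarith
  refine (measure_le_le_exp_mul_mgf _ ht0
    (hA.integrable_exp_sum_quadraticForm htr ht)).trans ?_
  refine (mul_le_mul_of_nonneg_left (hA.mgf_sum_quadraticForm_le htr ht) (exp_pos _).le).trans ?_
  have h := exp_neg_mul_inv_sqrt_pow_le (x := -ε) (by rwa [abs_neg, abs_of_pos hε0])
    (Fintype.card κ)
  rwa [neg_sq, ← sub_eq_add_neg] at h

end Tails



/-- Gaussian trace estimator bound: for an SPSD matrix `A` with `tr(A) > 0`, if the
sample size satisfies `n ≥ 8 ε⁻² ln(2/δ)` and `w₁, …, wₙ` are i.i.d. standard Gaussian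
vectors in `ℝ^s`, then `Pr(|tr_G(A) − tr(A)| ≤ ε tr(A)) ≥ 1 − δ`, where
`tr_G(A) = (1/n) ∑ₖ wₖᵀ A wₖ`. -/
theorem gaussian_trace_estimator_probabilistic_bound
    {Ω : Type*} [MeasurableSpace Ω] (μ : Measure Ω) [IsProbabilityMeasure μ]
    {s n : ℕ} (A : Matrix (Fin s) (Fin s) ℝ) (hA : A.PosSemidef) (htr : 0 < A.trace)
    (ε δ : ℝ) (hε : ε ∈ Set.Ioo (0 : ℝ) 1) (hδ : δ ∈ Set.Ioo (0 : ℝ) 1)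
    (hn : 8 * ε⁻¹ ^ 2 * Real.log (2 / δ) ≤ (n : ℝ))
    (w : Fin n → Ω → Fin s → ℝ)
    (hw : Measure.map (fun ω (p : Fin n × Fin s) => w p.1 ω p.2) μ =
      Measure.pi fun _ : Fin n × Fin s => gaussianReal 0 1) :
    ENNReal.ofReal (1 - δ) ≤
      μ {ω | |(1 / (n : ℝ)) * (∑ k, (w k ω) ⬝ᵥ A.mulVec (w k ω)) - A.trace| ≤
        ε * A.trace} := by
  obtain ⟨hε0, hε1⟩ := hε
  obtain ⟨hδ0, hδ1⟩ := hδ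
  have hlog : 0 < log (2 / δ) := log_pos (by rw [lt_div_iff₀ hδ0]; linarith)
  have hn0 : (0 : ℝ) < n := lt_of_lt_of_le (by positivity) hn
  have hexp : exp (-(n * (ε ^ 2 / 8))) ≤ δ / 2 := by
    rw [← inv_div 2 δ, ← exp_log (show 0 < 2 / δ by positivity), ← exp_neg]
    gcongr
    calc log (2 / δ) = 8 * ε⁻¹ ^ 2 * log (2 / δ) * (ε ^ 2 / 8) := by field_simp
      _ ≤ n * (ε ^ 2 / 8) := by gcongr
  let ν : Measure (Fin n → Fin s → ℝ) := Measure.pi fun _ => Measure.pi fun _ => gaussianReal 0 1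
  have hcurry := measurePreserving_curry_pi (ι := Fin n) (κ := Fin s) (gaussianReal 0 1)
  have hmeas : AEMeasurable (fun ω (p : Fin n × Fin s) => w p.1 ω p.2) μ := by
    refine AEMeasurable.of_map_ne_zero ?_
    rw [hw]
    exact IsProbabilityMeasure.ne_zero _
  have hlaw : μ.map (fun ω k => w k ω) = ν := by
    rw [show ν = _ from hcurry.map_eq.symm, ← hw,
      AEMeasurable.map_map_of_aemeasurable hcurry.measurable.aemeasurable hmeas]
    rfl
  have hmeas' : AEMeasurable (fun ω k => w k ω) μ := hcurry.measurable.comp_aemeasurable hmeas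
  let S : (Fin n → Fin s → ℝ) → ℝ := fun x => ∑ k, x k ⬝ᵥ A.mulVec (x k) / A.trace
  have hS : Measurable S := by
    have := measurable_quadraticForm A
    fun_prop
  have htail {T : Set (Fin n → Fin s → ℝ)} (hT : MeasurableSet T)
      (hle : ν.real T ≤ exp (-(Fintype.card (Fin n) * (ε ^ 2 / 8)))) :
      μ.real {ω | (fun k => w k ω) ∈ T} ≤ δ / 2 := by
    rw [Fintype.card_fin] at hle
    rw [← hlaw, map_measureReal_apply_of_aemeasurable hmeas' hT] at hle
    exact hle.trans hexp
  have hup := htail (measurableSet_le measurable_const hS)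
    (hA.measureReal_sum_quadraticForm_ge_le htr ⟨hε0, hε1⟩)
  have hlow := htail (measurableSet_le hS measurable_const)
    (hA.measureReal_sum_quadraticForm_le_le htr ⟨hε0, hε1⟩)
  have hcover : (Set.univ : Set Ω) ⊆
      {ω | |(1 / (n : ℝ)) * (∑ k, (w k ω) ⬝ᵥ A.mulVec (w k ω)) - A.trace| ≤ ε * A.trace} ∪
        ({ω | (fun k => w k ω) ∈ {x | Fintype.card (Fin n) * (1 + ε) ≤ S x}} ∪
          {ω | (fun k => w k ω) ∈ {x | S x ≤ Fintype.card (Fin n) * (1 - ε)}}) := by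
    intro ω _
    by_contra hω
    simp only [Set.mem_union, Set.mem_ofPred_eq, not_or, not_le, Fintype.card_fin] at hω
    obtain ⟨hgood, hu, hl⟩ := hω
    refine hgood.not_ge ?_
    have hSω : (1 / (n : ℝ)) * (∑ k, (w k ω) ⬝ᵥ A.mulVec (w k ω)) - A.trace =
        (S (fun k => w k ω) / n - 1) * A.trace := by
      simp only [S]
      rw [← Finset.sum_div]
      field_simp
    rw [hSω, abs_mul, abs_of_pos htr]
    gcongr
    rw [abs_le]
    constructor
    · rw [le_sub_iff_add_le, le_div_iff₀ hn0]; linarith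
    · rw [sub_le_iff_le_add, div_le_iff₀ hn0]; linarith
  have h1 := (measureReal_mono (μ := μ) hcover).trans
    ((measureReal_union_le _ _).trans (add_le_add_right (measureReal_union_le _ _) _))
  rw [probReal_univ] at h1
  refine ENNReal.ofReal_le_of_le_toReal ?_
  change 1 - δ ≤ μ.real _
  simp only [S] at h1
  linarith
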